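/- arXiv:0805.2710 — 3 statements merged into one kernel-verified Lean document; each statement's English description precedes it below -/
import Mathlib

section
/- Let ℵ = {𝒦 ⊆ 𝒫 : 𝒦 is weak*-compact and pω(x) ⊆ 𝒦 for m-almost every x ∈ M}. Then the set 𝒪 of all observable measures of f belongs to ℵ (in particular its basin of attraction B(𝒪) has full m-measure), and 𝒪 = ⋂_{𝒦 ∈ ℵ} 𝒦; consequently 𝒪 is the unique minimal element of ℵ, i.e., the minimal weak*-compact subset of 𝒫 whose basin of attraction has total m-measure. -/
open MeasureTheory Filter Set Topology
open scoped ENNReal NNReal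

/-- A metric on a topological space `P` (here: the space `𝒫` of Borel probability
measures with the weak* topology) inducing its topology; `d` plays the role of `dist*`. -/
structure CompatibleMetric (P : Type*) [TopologicalSpace P] where
  d : P → P → ℝ
  symm : ∀ x y, d x y = d y x
  triangle : ∀ x y z, d x z ≤ d x y + d y z
  eq_iff_dist_eq_zero : ∀ x y, d x y = 0 ↔ x = y
  nhds_iff : ∀ (x : P) (s : Set P), s ∈ nhds x ↔ ∃ ε > 0, {y | d x y < ε} ⊆ s

/-- The diameter of a set of measures w.r.t. the metric `D.d`. -/
noncomputable def diamD {P : Type*} [TopologicalSpace P] (D : CompatibleMetric P)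
    (A : Set P) : ℝ :=
  sSup (Set.image2 D.d A A)

variable {M : Type*} [MeasurableSpace M] [TopologicalSpace M] [OpensMeasurableSpace M]

/-- The empirical measure `σ_{n+1,x} = (1/(n+1)) ∑_{j=0}^{n} δ_{f^j(x)}`
(index shifted so that it is defined for every `n : ℕ`). -/
noncomputable def empiric (f : M → M) (x : M) (n : ℕ) : ProbabilityMeasure M :=
  ⟨((n : ℝ≥0∞) + 1)⁻¹ • ∑ j ∈ Finset.range (n + 1), Measure.dirac (f^[j] x), by
    constructor
    rw [Measure.smul_apply, Measure.finset_sum_apply]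
    simp only [measure_univ, Finset.sum_const, Finset.card_range, nsmul_eq_mul, mul_one,
      smul_eq_mul]
    rw [Nat.cast_add, Nat.cast_one]
    exact ENNReal.inv_mul_cancel (by simp)
      (ENNReal.add_ne_top.2 ⟨ENNReal.natCast_ne_top n, ENNReal.one_ne_top⟩)⟩

/-- `pω(x)`: the set of weak* limit points of the sequence of empirical measures
of the orbit of `x`. -/
def pomega (f : M → M) (x : M) : Set (ProbabilityMeasure M) :=
  {μ | MapClusterPt μ atTop (empiric f x)}

/-- The basin of attraction `B(K) = {x : pω(x) ⊆ K}` of a set of probability measures. -/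
def basin (f : M → M) (K : Set (ProbabilityMeasure M)) : Set M :=
  {x | pomega f x ⊆ K}

/-- `μ` is observable: for all `ε > 0` the `ε`-basin of partial attraction
`A_ε(μ) = {x : dist*(pω(x), μ) < ε}` has positive `m`-measure. -/
def Observable (D : CompatibleMetric (ProbabilityMeasure M)) (m : Measure M)
    (f : M → M) (μ : ProbabilityMeasure M) : Prop :=
  ∀ ε > 0, 0 < m {x | ∃ ν ∈ pomega f x, D.d ν μ < ε}

/-- `μ` is a physical measure: its basin `{x : pω(x) = {μ}}` has positive `m`-measure. -/
def PhysicalMeasure (m : Measure M) (f : M → M) (μ : ProbabilityMeasure M) : Prop :=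
  0 < m {x | pomega f x = {μ}}

/-- A generalized attractor (reduction of the set `𝒪` of observable measures): a nonempty
weak*-compact set of observable measures whose basin has positive `m`-measure. -/
def GenAttractor (D : CompatibleMetric (ProbabilityMeasure M)) (m : Measure M)
    (f : M → M) (A : Set (ProbabilityMeasure M)) : Prop :=
  A.Nonempty ∧ IsCompact A ∧ (∀ μ ∈ A, Observable D m f μ) ∧ 0 < m (basin f A)

/-- Two generalized attractors are independent if the basin of their intersection is null. -/
def IndepGA (m : Measure M) (f : M → M) (A B : Set (ProbabilityMeasure M)) : Prop :=
  m (basin f (A ∩ B)) = 0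

/-- A co-chain: an (at most countable) family of pairwise independent generalized attractors. -/
def IsCochain (D : CompatibleMetric (ProbabilityMeasure M)) (m : Measure M) (f : M → M)
    (S : Set (Set (ProbabilityMeasure M))) : Prop :=
  S.Countable ∧ (∀ A ∈ S, GenAttractor D m f A) ∧ S.Pairwise (IndepGA m f)

/-- A chain: a (finite or countably infinite) sequence, indexed by `I ⊆ ℕ`, of generalized
attractors that is strictly decreasing under inclusion. -/
def IsChainGA (D : CompatibleMetric (ProbabilityMeasure M)) (m : Measure M) (f : M → M)
    (I : Set ℕ) (c : ℕ → Set (ProbabilityMeasure M)) : Prop :=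
  I.Nonempty ∧ (∀ i ∈ I, GenAttractor D m f (c i)) ∧
    ∀ i ∈ I, ∀ j ∈ I, j < i → c i ⊂ c j

/-- Two chains are independent if each contains a member independent of some member
of the other. -/
def IndepChainPair (m : Measure M) (f : M → M)
    (p q : Set ℕ × (ℕ → Set (ProbabilityMeasure M))) : Prop :=
  (∃ i ∈ p.1, ∃ j ∈ q.1, IndepGA m f (p.2 i) (q.2 j)) ∧
    (∃ j ∈ q.1, ∃ i ∈ p.1, IndepGA m f (q.2 j) (p.2 i))

/-- `k`: the supremum of the lengths (cardinalities) of co-chains of generalized attractors. -/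
noncomputable def cochainSup (D : CompatibleMetric (ProbabilityMeasure M)) (m : Measure M)
    (f : M → M) : Cardinal :=
  sSup {c : Cardinal | ∃ S, IsCochain D m f S ∧ c = Cardinal.mk S}

/-- `h`: the supremum of the cardinalities of (at most countable) families of pairwise
independent chains of generalized attractors. -/
noncomputable def indepChainFamilySup (D : CompatibleMetric (ProbabilityMeasure M))
    (m : Measure M) (f : M → M) : Cardinal :=
  sSup {c : Cardinal | ∃ F : Set (Set ℕ × (ℕ → Set (ProbabilityMeasure M))),
    F.Countable ∧ (∀ p ∈ F, IsChainGA D m f p.1 p.2) ∧ F.Pairwise (IndepChainPair m f) ∧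
    c = Cardinal.mk F}

/-- An irreducible generalized attractor: one containing no proper compact subset that is
itself a generalized attractor. -/
def IrreducibleGA (D : CompatibleMetric (ProbabilityMeasure M)) (m : Measure M) (f : M → M)
    (A : Set (ProbabilityMeasure M)) : Prop :=
  GenAttractor D m f A ∧ ∀ K, IsCompact K → K ⊂ A → ¬ GenAttractor D m f K

/-- Observability depends only on the topology of the space of probability measures. -/
theorem observable_iff_forall_nhds (D : CompatibleMetric (ProbabilityMeasure M)) (m : Measure M)
    (f : M → M) (μ : ProbabilityMeasure M) :
    Observable D m f μ ↔ ∀ U ∈ 𝓝 μ, 0 < m {x | (pomega f x ∩ U).Nonempty} := by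
  constructor
  · intro h U hU
    obtain ⟨ε, hε, hεU⟩ := (D.nhds_iff μ U).1 hU
    refine (h ε hε).trans_le (measure_mono ?_)
    rintro x ⟨ν, hν, hνμ⟩
    exact ⟨ν, hν, hεU (by rwa [mem_ofPred_eq, D.symm])⟩
  · intro h ε hε
    refine (h {ν | D.d μ ν < ε} ((D.nhds_iff μ _).2 ⟨ε, hε, Subset.rfl⟩)).trans_le
      (measure_mono ?_)
    rintro x ⟨ν, hν, hνμ⟩
    exact ⟨ν, hν, by rwa [D.symm]⟩

theorem not_observable_iff_exists_open (D : CompatibleMetric (ProbabilityMeasure M))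
    (m : Measure M) (f : M → M) (μ : ProbabilityMeasure M) :
    ¬ Observable D m f μ ↔
      ∃ U, IsOpen U ∧ μ ∈ U ∧ m {x | (pomega f x ∩ U).Nonempty} = 0 := by
  rw [observable_iff_forall_nhds]
  push Not
  constructor
  · rintro ⟨U, hU, hm⟩
    obtain ⟨V, hVU, hV, hμV⟩ := mem_nhds_iff.1 hU
    exact ⟨V, hV, hμV, measure_mono_null
      (fun x hx ↦ hx.mono (inter_subset_inter_right _ hVU)) (nonpos_iff_eq_zero.1 hm)⟩
  · rintro ⟨U, hU, hμU, hm⟩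
    exact ⟨U, hU.mem_nhds hμU, hm.le⟩

theorem isClosed_setOf_observable (D : CompatibleMetric (ProbabilityMeasure M)) (m : Measure M)
    (f : M → M) : IsClosed {μ | Observable D m f μ} := by
  rw [← isOpen_compl_iff, isOpen_iff_mem_nhds]
  intro μ hμ
  obtain ⟨U, hU, hμU, hm⟩ := (not_observable_iff_exists_open D m f μ).1 hμ
  filter_upwards [hU.mem_nhds hμU] with ν hν
  exact (not_observable_iff_exists_open D m f ν).2 ⟨U, hU, hν, hm⟩

theorem ae_pomega_subset_setOf_observable [SecondCountableTopology (ProbabilityMeasure M)]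
    (D : CompatibleMetric (ProbabilityMeasure M)) (m : Measure M) (f : M → M) :
    ∀ᵐ x ∂m, pomega f x ⊆ {μ | Observable D m f μ} := by
  have hloc : ∀ μ ∈ {μ | Observable D m f μ}ᶜ,
      ∃ U, IsOpen U ∧ μ ∈ U ∧ m {x | (pomega f x ∩ U).Nonempty} = 0 :=
    fun μ hμ ↦ (not_observable_iff_exists_open D m f μ).1 hμ
  choose! U hU hmem hnull using hloc
  obtain ⟨T, hTsub, hT, hcover⟩ := TopologicalSpace.countable_cover_nhdsWithin
    fun μ hμ ↦ mem_nhdsWithin_of_mem_nhds ((hU μ hμ).mem_nhds (hmem μ hμ))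
  have hae : ∀ᵐ x ∂m, ∀ μ ∈ T, ¬ (pomega f x ∩ U μ).Nonempty := by
    rw [ae_ball_iff hT]
    intro μ hμ
    simpa [ae_iff] using hnull μ (hTsub hμ)
  filter_upwards [hae] with x hx ν hν
  by_contra hobs
  obtain ⟨μ, hμT, hνμ⟩ := mem_iUnion₂.1 (hcover hobs)
  exact hx μ hμT ⟨ν, hν, hνμ⟩

theorem setOf_observable_subset_of_isClosed (D : CompatibleMetric (ProbabilityMeasure M))
    {m : Measure M} {f : M → M} {K : Set (ProbabilityMeasure M)} (hK : IsClosed K)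
    (hae : ∀ᵐ x ∂m, pomega f x ⊆ K) : {μ | Observable D m f μ} ⊆ K := by
  intro μ hμ
  by_contra hμK
  refine (not_observable_iff_exists_open D m f μ).2
    ⟨Kᶜ, hK.isOpen_compl, hμK, measure_mono_null ?_ (ae_iff.1 hae)⟩ hμ
  rintro x ⟨ν, hν, hνK⟩ hsub
  exact hνK (hsub hν)

/-- Theorem (Attracting minimality of `𝒪`): `𝒪` belongs to the family `ℵ` of compact sets
containing `pω(x)` for a.e. `x` (in particular its basin has full measure), and
`𝒪 = ⋂₀ ℵ`, so it is the unique minimal element of `ℵ`. -/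
theorem observable_minimal_attracting {M : Type*} [MetricSpace M] [CompactSpace M] [MeasurableSpace M] [BorelSpace M]
    (D : CompatibleMetric (ProbabilityMeasure M))
    (m : Measure M) [IsProbabilityMeasure m]
    (f : M → M) (hf : Continuous f) :
    ({μ : ProbabilityMeasure M | Observable D m f μ} ∈
        {K : Set (ProbabilityMeasure M) | IsCompact K ∧ ∀ᵐ x ∂m, pomega f x ⊆ K}) ∧
      m (basin f {μ : ProbabilityMeasure M | Observable D m f μ}) = 1 ∧
      {μ : ProbabilityMeasure M | Observable D m f μ} =
        ⋂₀ {K : Set (ProbabilityMeasure M) | IsCompact K ∧ ∀ᵐ x ∂m, pomega f x ⊆ K} := by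
  have hae := ae_pomega_subset_setOf_observable D m f
  have hmem : {μ : ProbabilityMeasure M | Observable D m f μ} ∈
      {K : Set (ProbabilityMeasure M) | IsCompact K ∧ ∀ᵐ x ∂m, pomega f x ⊆ K} :=
    ⟨(isClosed_setOf_observable D m f).isCompact, hae⟩
  refine ⟨hmem, ?_, Subset.antisymm ?_ (sInter_subset_of_mem hmem)⟩
  · exact (measure_congr (eventuallyEq_univ.2 hae)).trans measure_univ
  · exact subset_sInter fun K hK ↦ setOf_observable_subset_of_isClosed D hK.1.isClosed hK.2
end

section
/- For every x ∈ M: if μ, ν ∈ pω(x), then for each real number λ with 0 ≤ λ ≤ 1 there exists a measure μ_λ ∈ pω(x) such that dist*(μ_λ, μ) = λ · dist*(μ, ν). -/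
open MeasureTheory Filter Set Topology
open scoped ENNReal NNReal

variable {M : Type*} [MeasurableSpace M] [TopologicalSpace M] [OpensMeasurableSpace M]

namespace CompatibleMetric

variable {P : Type*} [TopologicalSpace P] (D : CompatibleMetric P)

theorem nonneg (p q : P) : 0 ≤ D.d p q := by
  have h := D.triangle p q p
  rw [(D.eq_iff_dist_eq_zero p p).2 rfl, D.symm q p] at h
  linarith

/-- The distance to a fixed point is continuous. -/
theorem continuous_dist_right (q : P) : Continuous fun p => D.d p q := by
  refine continuous_iff_continuousAt.2 fun p => Metric.tendsto_nhds.2 fun ε hε => ?_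
  refine (D.nhds_iff p _).2 ⟨ε, hε, fun r (hr : D.d p r < ε) => ?_⟩
  have h₁ := D.triangle p r q
  have h₂ := D.triangle r p q
  rw [D.symm r p] at h₂
  rw [mem_ofPred_eq, Real.dist_eq, abs_lt]
  constructor <;> linarith

end CompatibleMetric

/-- A sequence that is frequently below and frequently above a level crosses it upwards
infinitely often. -/
theorem frequently_le_and_lt_succ {α : Type*} [LinearOrder α] {g : ℕ → α} {c : α}
    (hlt : ∃ᶠ n in atTop, g n < c) (hgt : ∃ᶠ n in atTop, c < g n) :
    ∃ᶠ n in atTop, g n ≤ c ∧ c < g (n + 1) := by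
  by_contra h
  obtain ⟨N, hN⟩ := eventually_atTop.1 (not_frequently.1 h)
  obtain ⟨n, hnN, hn⟩ := frequently_atTop.1 hlt N
  obtain ⟨m, hmn, hm⟩ := frequently_atTop.1 hgt n
  have hle : ∀ k ≥ n, g k ≤ c := fun k hk => by
    induction k, hk using Nat.le_induction with
    | base => exact hn.le
    | succ k hk ih => exact not_lt.1 fun hlt => hN k (hnN.trans hk) ⟨ih, hlt⟩
  exact (hle m hmn).not_gt hm

theorem integral_empiric (f : M → M) (x : M) (n : ℕ) (φ : BoundedContinuousFunction M ℝ) :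
    ∫ y, φ y ∂(empiric f x n : Measure M) =
      ((n : ℝ) + 1)⁻¹ * ∑ j ∈ Finset.range (n + 1), φ (f^[j] x) := by
  change ∫ y, φ y ∂(((n : ℝ≥0∞) + 1)⁻¹ •
    ∑ j ∈ Finset.range (n + 1), Measure.dirac (f^[j] x)) = _
  rw [integral_smul_measure, integral_finsetSum_measure fun j _ => φ.integrable _]
  simp only [integral_dirac' _ _ φ.continuous.measurable.stronglyMeasurable]
  rw [ENNReal.toReal_inv, ENNReal.toReal_add (by simp) (by simp)]
  simp

/-- Consecutive empirical integrals of a bounded function differ by `O(1 / n)`. -/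
theorem tendsto_integral_empiric_succ_sub (f : M → M) (x : M)
    (φ : BoundedContinuousFunction M ℝ) :
    Tendsto (fun n => ∫ y, φ y ∂(empiric f x (n + 1) : Measure M) -
      ∫ y, φ y ∂(empiric f x n : Measure M)) atTop (𝓝 0) := by
  refine squeeze_zero_norm (a := fun n : ℕ => 2 * ‖φ‖ * (1 / ((n : ℝ) + 1))) (fun n => ?_) ?_
  · have hpos : (0 : ℝ) < (n : ℝ) + 1 := by positivity
    have hI : ‖∫ y, φ y ∂(empiric f x n : Measure M)‖ ≤ ‖φ‖ := φ.norm_integral_le_norm _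
    have hφ : ‖φ (f^[n + 1] x)‖ ≤ ‖φ‖ := φ.norm_coe_le_norm _
    have key : ∫ y, φ y ∂(empiric f x (n + 1) : Measure M) -
        ∫ y, φ y ∂(empiric f x n : Measure M) =
        (φ (f^[n + 1] x) - ∫ y, φ y ∂(empiric f x n : Measure M)) * (1 / ((n : ℝ) + 2)) := by
      rw [integral_empiric, integral_empiric, Finset.sum_range_succ _ (n + 1)]
      push_cast
      field_simp
      ring
    rw [key, norm_mul]
    refine mul_le_mul ((norm_sub_le _ _).trans (by linarith)) ?_ (norm_nonneg _) (by positivity)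
    rw [Real.norm_of_nonneg (by positivity)]
    exact one_div_le_one_div_of_le hpos (by linarith)
  · simpa using tendsto_one_div_add_atTop_nhds_zero_nat.const_mul (2 * ‖φ‖)

theorem tendsto_empiric_succ {f : M → M} {x : M} {l : Filter ℕ} (hl : l ≤ atTop)
    {μ : ProbabilityMeasure M} (h : Tendsto (empiric f x) l (𝓝 μ)) :
    Tendsto (fun n => empiric f x (n + 1)) l (𝓝 μ) := by
  rw [ProbabilityMeasure.tendsto_iff_forall_integral_tendsto] at h ⊢
  intro φ
  simpa using ((tendsto_integral_empiric_succ_sub f x φ).mono_left hl).add (h φ)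

/-- Convex-like property: if `μ, ν ∈ pω(x)` and `0 ≤ λ ≤ 1`, then there is
`μ_λ ∈ pω(x)` with `dist*(μ_λ, μ) = λ · dist*(μ, ν)`. -/
theorem pomega_convex_like {M : Type*} [MetricSpace M] [CompactSpace M] [MeasurableSpace M] [BorelSpace M]
    (D : CompatibleMetric (ProbabilityMeasure M))
    (f : M → M) (hf : Continuous f) (x : M)
    (mu nu : ProbabilityMeasure M) (hmu : mu ∈ pomega f x) (hnu : nu ∈ pomega f x)
    (lam : ℝ) (h0 : 0 ≤ lam) (h1 : lam ≤ 1) :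
    ∃ mulam ∈ pomega f x, D.d mulam mu = lam * D.d mu nu := by
  set L := D.d mu nu with hL
  rcases h0.eq_or_lt with rfl | h0
  · exact ⟨mu, hmu, by rw [zero_mul, D.eq_iff_dist_eq_zero]⟩
  rcases h1.eq_or_lt with rfl | h1
  · exact ⟨nu, hnu, by rw [one_mul, D.symm]⟩
  rcases (D.nonneg mu nu).eq_or_lt with hzero | hpos
  · exact ⟨mu, hmu, by rw [hL, ← hzero, mul_zero, D.eq_iff_dist_eq_zero]⟩
  have hcont := D.continuous_dist_right mu
  have hlt : ∃ᶠ n in atTop, D.d (empiric f x n) mu < lam * L := by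
    refine (mapClusterPt_iff_frequently.1 hmu) _
      (hcont.continuousAt.eventually_lt continuousAt_const ?_)
    rw [(D.eq_iff_dist_eq_zero mu mu).2 rfl]
    exact mul_pos h0 hpos
  have hgt : ∃ᶠ n in atTop, lam * L < D.d (empiric f x n) mu := by
    refine (mapClusterPt_iff_frequently.1 hnu) _
      (continuousAt_const.eventually_lt hcont.continuousAt ?_)
    rw [D.symm nu mu]
    exact mul_lt_of_lt_one_left hpos h1
  have : NeBot (atTop ⊓ 𝓟 {n | D.d (empiric f x n) mu ≤ lam * L ∧
      lam * L < D.d (empiric f x (n + 1)) mu}) :=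
    frequently_mem_iff_neBot.1 (frequently_le_and_lt_succ hlt hgt)
  obtain ⟨U, hU⟩ := Ultrafilter.exists_le (atTop ⊓ 𝓟 {n | D.d (empiric f x n) mu ≤ lam * L ∧
      lam * L < D.d (empiric f x (n + 1)) mu})
  have hUtop : (U : Filter ℕ) ≤ atTop := hU.trans inf_le_left
  have hcross : ∀ᶠ n in (U : Filter ℕ), D.d (empiric f x n) mu ≤ lam * L ∧
      lam * L < D.d (empiric f x (n + 1)) mu := le_principal_iff.1 (hU.trans inf_le_right)
  obtain ⟨ρ, -, hρ⟩ := isCompact_univ.ultrafilter_le_nhds (U.map (empiric f x)) (by simp)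
  have hρ : Tendsto (empiric f x) U (𝓝 ρ) := hρ
  refine ⟨ρ, mapClusterPt_iff_ultrafilter.2 ⟨U, hUtop, hρ⟩, le_antisymm ?_ ?_⟩
  · exact le_of_tendsto ((hcont.tendsto ρ).comp hρ) (hcross.mono fun _ h => h.1)
  · exact ge_of_tendsto ((hcont.tendsto ρ).comp (tendsto_empiric_succ hUtop hρ))
      (hcross.mono fun _ h => h.2.le)
end

section
/- The supremum k of the lengths of co-chains of generalized attractors of f equals the supremum h of the cardinalities of families of pairwise independent chains of generalized attractors of f. Moreover, for any co-chain of length l there is a family of l pairwise independent chains, and conversely, for any family of l pairwise independent chains there is a co-chain of length l. -/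
open MeasureTheory Filter Set Topology
open scoped ENNReal NNReal

variable {M : Type*} [MeasurableSpace M] [TopologicalSpace M] [OpensMeasurableSpace M]

/-- Two elements of a preorder are compatible if they have a common lower bound. -/
def LowerCompatible {P : Type*} [Preorder P] (a b : P) : Prop :=
  ∃ c, c ≤ a ∧ c ≤ b

section Order

variable {P : Type*} [Preorder P]

theorem LowerCompatible.symm {a b : P} (h : LowerCompatible a b) : LowerCompatible b a := by
  obtain ⟨c, ha, hb⟩ := h
  exact ⟨c, hb, ha⟩

theorem LowerCompatible.mono {a b a' b' : P} (h : LowerCompatible a b) (ha : a ≤ a')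
    (hb : b ≤ b') : LowerCompatible a' b' := by
  obtain ⟨c, hca, hcb⟩ := h
  exact ⟨c, hca.trans ha, hcb.trans hb⟩

/-- If every pairwise incompatible set is finite, then below every element there is one whose
lower bounds are pairwise compatible. -/
theorem exists_le_forall_lowerCompatible
    (hfin : ∀ S : Set P, S.Pairwise (fun a b => ¬ LowerCompatible a b) → S.Finite) (a : P) :
    ∃ b ≤ a, ∀ x ≤ b, ∀ y ≤ b, LowerCompatible x y := by
  have hwf : WellFounded fun b a : P => b ≤ a ∧ ∃ c ≤ a, ¬ LowerCompatible c b := by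
    rw [wellFounded_iff_isEmpty_descending_chain]
    refine ⟨fun ⟨b, hb⟩ => ?_⟩
    choose hle c hc hcb using hb
    have hanti : Antitone b := antitone_nat_of_succ_le hle
    have hlt : ∀ i j, i < j → ¬ LowerCompatible (c i) (c j) := fun i j hij h =>
      hcb i (h.mono le_rfl ((hc j).trans (hanti hij)))
    have hne : ∀ i j, i ≠ j → ¬ LowerCompatible (c i) (c j) := fun i j hij h =>
      hij.lt_or_gt.elim (fun hl => hlt i j hl h) (fun hl => hlt j i hl h.symm)
    have hinj : Function.Injective c := by
      intro i j hij
      by_contra hn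
      exact hne i j hn ⟨c i, le_rfl, hij.le⟩
    refine Set.infinite_range_of_injective hinj (hfin _ ?_)
    rintro _ ⟨i, rfl⟩ _ ⟨j, rfl⟩ hij
    exact hne i j fun h => hij (congrArg c h)
  obtain ⟨b, hb, hmin⟩ := hwf.has_min {b | b ≤ a} ⟨a, le_rfl⟩
  refine ⟨b, hb, fun x hx y hy => ?_⟩
  by_contra hxy
  exact hmin y (le_trans hy hb) ⟨hy, x, hx, hxy⟩

/-- If every pairwise incompatible set is finite, then there is a finite set of elements, each
with pairwise compatible lower bounds, such that every element is compatible with one of them. -/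
theorem exists_finite_forall_lowerCompatible
    (hfin : ∀ S : Set P, S.Pairwise (fun a b => ¬ LowerCompatible a b) → S.Finite) :
    ∃ T : Set P, T.Finite ∧ (∀ t ∈ T, ∀ x ≤ t, ∀ y ≤ t, LowerCompatible x y) ∧
      ∀ a, ∃ t ∈ T, LowerCompatible t a := by
  obtain ⟨T, hT⟩ := zorn_subset {T : Set P | T.Pairwise (fun a b => ¬ LowerCompatible a b) ∧
      ∀ t ∈ T, ∀ x ≤ t, ∀ y ≤ t, LowerCompatible x y} (by
    intro C hC hchain
    refine ⟨⋃₀ C, ⟨(Set.pairwise_sUnion hchain.directedOn).2 fun s hs => (hC hs).1, ?_⟩,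
      fun s hs => Set.subset_sUnion_of_mem hs⟩
    rintro t ⟨s, hs, hts⟩
    exact (hC hs).2 t hts)
  refine ⟨T, hfin T hT.prop.1, hT.prop.2, fun a => ?_⟩
  by_contra! ha
  obtain ⟨b, hba, hb⟩ := exists_le_forall_lowerCompatible hfin a
  have hbT : ∀ t ∈ T, ¬ LowerCompatible t b := fun t ht h => ha t ht (h.mono le_rfl hba)
  have hins : insert b T ⊆ T := by
    refine hT.le_of_ge ⟨(Set.pairwise_insert).2 ⟨hT.prop.1, fun t ht _ =>
      ⟨fun h => hbT t ht h.symm, hbT t ht⟩⟩, ?_⟩ (Set.subset_insert b T)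
    rintro t (rfl | ht)
    exacts [hb, hT.prop.2 t ht]
  exact hbT b (hins (Set.mem_insert b T)) ⟨b, le_rfl, le_rfl⟩

/-- From countably many downward directed sets, any two of which contain incompatible
elements, one gets equally many pairwise incompatible elements. -/
theorem exists_pairwise_not_lowerCompatible {ι : Type*} [Countable ι] (C : ι → Set P)
    (hne : ∀ i, (C i).Nonempty) (hdir : ∀ i, DirectedOn (· ≥ ·) (C i))
    (hC : Pairwise fun i j => ∃ a ∈ C i, ∃ b ∈ C j, ¬ LowerCompatible a b) :
    ∃ z : ι → P, Pairwise fun i j => ¬ LowerCompatible (z i) (z j) := by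
  have (i : ι) : Nonempty (C i) := (hne i).to_subtype
  by_cases hfin : ∀ S : Set P, S.Pairwise (fun a b => ¬ LowerCompatible a b) → S.Finite
  · obtain ⟨T, hTfin, hT, hTmax⟩ := exists_finite_forall_lowerCompatible hfin
    have : Finite T := hTfin
    have hex : ∀ i, ∃ t : T, ∀ x : C i, LowerCompatible (t : P) x := by
      intro i
      by_contra! h
      choose g hg using h
      obtain ⟨z, hz⟩ := (hdir i).directed_val.finite_le g
      obtain ⟨t, ht, htz⟩ := hTmax z
      exact hg ⟨t, ht⟩ (htz.mono le_rfl (hz ⟨t, ht⟩))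
    choose t ht using hex
    have htinj : Function.Injective t := by
      intro i j hij
      by_contra hn
      obtain ⟨a, ha, b, hb, hab⟩ := hC hn
      obtain ⟨x, hxt, hxa⟩ := ht i ⟨a, ha⟩
      obtain ⟨y, hyt, hyb⟩ := ht j ⟨b, hb⟩
      rw [← hij] at hyt
      exact hab ((hT _ (t i).2 x hxt y hyt).mono hxa hyb)
    have : Finite ι := Finite.of_injective t htinj
    have hC' : ∀ i j, ∃ a : C i, ∃ b : C j, i ≠ j → ¬ LowerCompatible (a : P) b := by
      intro i j
      by_cases hij : i = j
      · exact ⟨Classical.arbitrary _, Classical.arbitrary _, fun h => absurd hij h⟩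
      · obtain ⟨a, ha, b, hb, hab⟩ := hC hij
        exact ⟨⟨a, ha⟩, ⟨b, hb⟩, fun _ => hab⟩
    choose a b hab using hC'
    choose z hz using fun i => (hdir i).directed_val.finite_le (Sum.elim (a i) fun j => b j i)
    exact ⟨fun i => z i, fun i j hij h =>
      hab i j hij (h.mono (hz i (Sum.inl j)) (hz j (Sum.inr i)))⟩
  · push Not at hfin
    obtain ⟨S, hS, hinf⟩ := hfin
    obtain ⟨e, he⟩ := exists_injective_nat ι
    have : Infinite S := Set.infinite_coe_iff.2 hinf
    let s := Infinite.natEmbedding S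
    refine ⟨fun i => s (e i), fun i j hij => hS (s (e i)).2 (s (e j)).2 fun h => hij ?_⟩
    exact he (s.injective (Subtype.ext h))

end Order

section Attractors

variable {M : Type*} [MetricSpace M] [MeasurableSpace M] [BorelSpace M]
variable {D : CompatibleMetric (ProbabilityMeasure M)} {m : Measure M} {f : M → M}

theorem basin_mono (f : M → M) {A B : Set (ProbabilityMeasure M)} (h : A ⊆ B) :
    basin f A ⊆ basin f B :=
  fun _ hx => Set.Subset.trans hx h

theorem not_indepGA_self {A : Set (ProbabilityMeasure M)} (hA : GenAttractor D m f A) :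
    ¬ IndepGA m f A A := by
  rw [IndepGA, Set.inter_self]
  exact hA.2.2.2.ne'

theorem exists_indepChainFamily_of_isCochain {S : Set (Set (ProbabilityMeasure M))}
    (hS : IsCochain D m f S) :
    ∃ F : Set (Set ℕ × (ℕ → Set (ProbabilityMeasure M))),
      F.Countable ∧ (∀ p ∈ F, IsChainGA D m f p.1 p.2) ∧
      F.Pairwise (IndepChainPair m f) ∧ Cardinal.mk F = Cardinal.mk S := by
  refine ⟨(fun A => ({0}, fun _ => A)) '' S, hS.1.image _, ?_, ?_,
    Cardinal.mk_image_eq fun A B h => congrFun (congrArg Prod.snd h) 0⟩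
  · rintro _ ⟨A, hA, rfl⟩
    refine ⟨Set.singleton_nonempty 0, fun _ _ => hS.2.1 A hA, ?_⟩
    rintro i rfl j rfl h
    exact absurd h (lt_irrefl _)
  · rintro _ ⟨A, hA, rfl⟩ _ ⟨B, hB, rfl⟩ hne
    have hAB : A ≠ B := fun h => hne (by rw [h])
    exact ⟨⟨0, rfl, 0, rfl, hS.2.2 hA hB hAB⟩, ⟨0, rfl, 0, rfl, hS.2.2 hB hA hAB.symm⟩⟩

variable [CompactSpace M]

theorem pomega_nonempty (f : M → M) (x : M) : (pomega f x).Nonempty :=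
  exists_clusterPt_of_compactSpace (map (empiric f x) atTop)

theorem basin_empty (f : M → M) : basin f ∅ = ∅ :=
  Set.eq_empty_of_forall_notMem fun x hx =>
    (pomega_nonempty f x).ne_empty (Set.subset_empty_iff.1 hx)

theorem GenAttractor.inter {A B : Set (ProbabilityMeasure M)} (hA : GenAttractor D m f A)
    (hB : GenAttractor D m f B) (h : ¬ IndepGA m f A B) : GenAttractor D m f (A ∩ B) := by
  refine ⟨?_, hA.2.1.inter hB.2.1, fun μ hμ => hA.2.2.1 μ hμ.1, pos_iff_ne_zero.2 h⟩
  by_contra hempty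
  rw [Set.not_nonempty_iff_eq_empty] at hempty
  exact h (by rw [IndepGA, hempty, basin_empty, measure_empty])

theorem not_lowerCompatible_iff_indepGA (A B : {A // GenAttractor D m f A}) :
    ¬ LowerCompatible A B ↔ IndepGA m f A.1 B.1 := by
  constructor
  · intro h
    by_contra hn
    exact h ⟨⟨_, A.2.inter B.2 hn⟩, Set.inter_subset_left, Set.inter_subset_right⟩
  · rintro h ⟨K, hKA, hKB⟩
    exact K.2.2.2.2.ne' (measure_mono_null (basin_mono f (Set.subset_inter hKA hKB)) h)

theorem exists_isCochain_of_indepChainFamily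
    {F : Set (Set ℕ × (ℕ → Set (ProbabilityMeasure M)))} (hF : F.Countable)
    (hchain : ∀ p ∈ F, IsChainGA D m f p.1 p.2) (hindep : F.Pairwise (IndepChainPair m f)) :
    ∃ S : Set (Set (ProbabilityMeasure M)),
      IsCochain D m f S ∧ Cardinal.mk S = Cardinal.mk F := by
  have : Countable F := hF.to_subtype
  obtain ⟨z, hz⟩ := exists_pairwise_not_lowerCompatible
    (fun p : F => {A : {A // GenAttractor D m f A} | ∃ i ∈ p.1.1, p.1.2 i = A.1})
    (by
      rintro ⟨p, hp⟩
      obtain ⟨i, hi⟩ := (hchain p hp).1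
      exact ⟨⟨p.2 i, (hchain p hp).2.1 i hi⟩, i, hi, rfl⟩)
    (by
      rintro ⟨p, hp⟩ A ⟨i, hi, hA⟩ B ⟨j, hj, hB⟩
      have hanti : ∀ i ∈ p.1, ∀ j ∈ p.1, i ≤ j → p.2 j ⊆ p.2 i := by
        intro i hi j hj hij
        obtain rfl | hlt := hij.eq_or_lt
        · exact subset_rfl
        · exact ((hchain p hp).2.2 j hj i hi hlt).subset
      rcases le_total i j with h | h
      · refine ⟨B, ⟨j, hj, hB⟩, ?_, le_rfl⟩
        change B.1 ⊆ A.1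
        rw [← hA, ← hB]
        exact hanti i hi j hj h
      · refine ⟨A, ⟨i, hi, hA⟩, le_rfl, ?_⟩
        change A.1 ⊆ B.1
        rw [← hA, ← hB]
        exact hanti j hj i hi h)
    (by
      rintro ⟨p, hp⟩ ⟨q, hq⟩ hpq
      obtain ⟨i, hi, j, hj, hij⟩ := (hindep hp hq fun h => hpq (Subtype.ext h)).1
      exact ⟨⟨p.2 i, (hchain p hp).2.1 i hi⟩, ⟨i, hi, rfl⟩,
        ⟨q.2 j, (hchain q hq).2.1 j hj⟩, ⟨j, hj, rfl⟩,
        (not_lowerCompatible_iff_indepGA _ _).2 hij⟩)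
  have hz' : ∀ p q, p ≠ q → IndepGA m f (z p).1 (z q).1 := fun p q hpq =>
    (not_lowerCompatible_iff_indepGA _ _).1 (hz hpq)
  have hinj : Function.Injective fun p => (z p).1 := by
    intro p q (hpq : (z p).1 = (z q).1)
    by_contra hn
    have h := hz' p q hn
    rw [← hpq] at h
    exact not_indepGA_self (z p).2 h
  refine ⟨Set.range fun p => (z p).1, ⟨Set.countable_range _, ?_, ?_⟩,
    Cardinal.mk_range_eq _ hinj⟩
  · rintro _ ⟨p, rfl⟩
    exact (z p).2
  · rintro _ ⟨p, rfl⟩ _ ⟨q, rfl⟩ hpq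
    exact hz' p q fun h => hpq (by rw [h])

end Attractors

/-- Dilworth-type theorem: the supremum `k` of lengths of co-chains equals the supremum
`h` of cardinalities of families of pairwise independent chains; moreover any co-chain of
length `l` yields `l` pairwise independent chains and conversely. -/
theorem cochainSup_eq_indepChainFamilySup {M : Type*} [MetricSpace M] [CompactSpace M] [MeasurableSpace M] [BorelSpace M]
    (D : CompatibleMetric (ProbabilityMeasure M))
    (m : Measure M) [IsProbabilityMeasure m]
    (f : M → M) (hf : Continuous f) :
    cochainSup D m f = indepChainFamilySup D m f ∧
    (∀ S : Set (Set (ProbabilityMeasure M)), IsCochain D m f S →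
      ∃ F : Set (Set ℕ × (ℕ → Set (ProbabilityMeasure M))),
        F.Countable ∧ (∀ p ∈ F, IsChainGA D m f p.1 p.2) ∧
        F.Pairwise (IndepChainPair m f) ∧ Cardinal.mk F = Cardinal.mk S) ∧
    (∀ F : Set (Set ℕ × (ℕ → Set (ProbabilityMeasure M))),
      F.Countable → (∀ p ∈ F, IsChainGA D m f p.1 p.2) →
      F.Pairwise (IndepChainPair m f) →
        ∃ S : Set (Set (ProbabilityMeasure M)),
          IsCochain D m f S ∧ Cardinal.mk S = Cardinal.mk F) := by
  refine ⟨?_, fun S hS => exists_indepChainFamily_of_isCochain hS,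
    fun F hF hchain hindep => exists_isCochain_of_indepChainFamily hF hchain hindep⟩
  unfold cochainSup indepChainFamilySup
  congr 1
  ext c
  constructor
  · rintro ⟨S, hS, rfl⟩
    obtain ⟨F, hF, hchain, hindep, hcard⟩ := exists_indepChainFamily_of_isCochain hS
    exact ⟨F, hF, hchain, hindep, hcard.symm⟩
  · rintro ⟨F, hF, hchain, hindep, rfl⟩
    obtain ⟨S, hS, hcard⟩ := exists_isCochain_of_indepChainFamily hF hchain hindep
    exact ⟨S, hS, hcard.symm⟩
end
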